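/- Fix 0 < R < 2 and c > 1 with cR < 2. For each d, let h_d be the cross-polytope hash under a matrix G ∈ ℝ^{d×d} with i.i.d. N(0,1) entries. Then for any sequences of unit vectors x_d, y_d ∈ S^{d−1} with ‖x_d − y_d‖₂ = R and x'_d, y'_d ∈ S^{d−1} with ‖x'_d − y'_d‖₂ = cR, the sensitivity exponent ρ_d = ln(1/Pr[h_d(x_d) = h_d(y_d)]) / ln(1/Pr[h_d(x'_d) = h_d(y'_d)]) satisfies lim_{d→∞} ρ_d = (1/c²)·(4 − c²R²)/(4 − R²). -/

import Mathlib

open MeasureTheory ProbabilityTheory Filter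

/-- The law of a `k × m` matrix with i.i.d. standard Gaussian entries. -/
noncomputable def gaussMatrix (k m : ℕ) : Measure (Fin k → Fin m → ℝ) :=
  Measure.pi fun _ => Measure.pi fun _ => gaussianReal 0 1

/-- `(Av)_i` for a matrix `A` given by rows and a vector `v`. -/
def mvMul {k m : ℕ} (A : Fin k → Fin m → ℝ) (v : Fin m → ℝ) (i : Fin k) : ℝ :=
  ∑ j, A i j * v j

/-- The event that `v` cross-polytope hashes to `s·e_i` under `A`, via strict inequalities. -/
def hashAt {k m : ℕ} (A : Fin k → Fin m → ℝ) (v : Fin m → ℝ) (i : Fin k) (s : ℝ) : Prop :=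
  ∀ j, j ≠ i → |mvMul A v j| < s * mvMul A v i

/-- The event that `v` and `w` receive the same cross-polytope hash under `A`. -/
def collide {k m : ℕ} (A : Fin k → Fin m → ℝ) (v w : Fin m → ℝ) : Prop :=
  ∃ (i : Fin k) (s : ℝ), (s = 1 ∨ s = -1) ∧ hashAt A v i s ∧ hashAt A w i s

/-- The collision probability of `x, y ∈ ℝ^d` under cross-polytope LSH with a `d × d`
i.i.d. standard Gaussian matrix. -/
noncomputable def collProb (d : ℕ) (x y : Fin d → ℝ) : ℝ :=
  (gaussMatrix d d {A | collide A x y}).toReal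

section GaussianTail

lemma gaussianReal_real_Ici_le {t : ℝ} (ht : 0 ≤ t) :
    (gaussianReal 0 1).real (Set.Ici t) ≤ Real.exp (-t ^ 2 / 2) := by
  have h : HasSubgaussianMGF (id : ℝ → ℝ) 1 (gaussianReal 0 1) :=
    ⟨fun s => by simpa using integrable_exp_mul_gaussianReal (μ := 0) (v := 1) s,
      fun s => by simp [mgf_id_gaussianReal]⟩
  simpa [Set.Ici] using h.measure_ge_le ht

lemma le_gaussianReal_real_Icc {t : ℝ} (ht : 0 ≤ t) :
    (√(2 * Real.pi))⁻¹ * Real.exp (-(t + 1) ^ 2 / 2) ≤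
      (gaussianReal 0 1).real (Set.Icc t (t + 1)) := by
  rw [measureReal_def, gaussianReal_apply_eq_integral 0 one_ne_zero,
    ENNReal.toReal_ofReal (integral_nonneg fun x => gaussianPDFReal_nonneg _ _ _)]
  have h := setIntegral_mono_on (μ := volume) (s := Set.Icc t (t + 1))
    (f := fun _ => (√(2 * Real.pi))⁻¹ * Real.exp (-(t + 1) ^ 2 / 2))
    (g := gaussianPDFReal 0 1) continuous_const.integrableOn_Icc
    (integrable_gaussianPDFReal 0 1).integrableOn
    measurableSet_Icc (by
      rintro x ⟨hx₁, hx₂⟩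
      simp only [gaussianPDFReal, NNReal.coe_one, mul_one, sub_zero]
      gcongr
      linarith)
  simpa using h

lemma le_gaussianReal_real_Ici {t : ℝ} (ht : 0 ≤ t) :
    (√(2 * Real.pi))⁻¹ * Real.exp (-(t + 1) ^ 2 / 2) ≤
      (gaussianReal 0 1).real (Set.Ici t) :=
  (le_gaussianReal_real_Icc ht).trans (measureReal_mono Set.Icc_subset_Ici_self)

end GaussianTail

section GaussianRow

variable {d : ℕ}

/-- The law of a vector with `d` i.i.d. standard Gaussian entries. -/
noncomputable abbrev gaussRow (d : ℕ) : Measure (Fin d → ℝ) :=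
  Measure.pi fun _ => gaussianReal 0 1

/-- The inner product of a row with a vector. -/
def rowDot (a v : Fin d → ℝ) : ℝ := ∑ j, a j * v j

lemma measurable_rowDot (v : Fin d → ℝ) : Measurable fun a => rowDot a v := by
  unfold rowDot; fun_prop

lemma rowDot_eq_inner (a : Fin d → ℝ) (v : EuclideanSpace ℝ (Fin d)) :
    rowDot a v = inner ℝ v (WithLp.toLp 2 a) := by
  simp [rowDot, PiLp.inner_apply]

lemma hasGaussianLaw_toLp_gaussRow : HasGaussianLaw (WithLp.toLp 2) (gaussRow d) :=
  ⟨by rw [map_pi_eq_stdGaussian]; infer_instance⟩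

lemma covariance_rowDot (u v : EuclideanSpace ℝ (Fin d)) :
    cov[fun a => rowDot a u, fun a => rowDot a v; gaussRow d] = inner ℝ u v := by
  simp_rw [rowDot_eq_inner]
  rw [← covariance_map_fun (μ := gaussRow d) (Z := WithLp.toLp 2)
    (X := fun z : EuclideanSpace ℝ (Fin d) => inner ℝ u z)
    (Y := fun z : EuclideanSpace ℝ (Fin d) => inner ℝ v z) (by fun_prop) (by fun_prop)
    (by fun_prop), map_pi_eq_stdGaussian,
    ← covarianceBilin_apply_eq_cov IsGaussian.memLp_two_id, covarianceBilin_stdGaussian,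
    innerSL_apply_apply]

lemma integral_rowDot (u : EuclideanSpace ℝ (Fin d)) :
    ∫ a, rowDot a u ∂(gaussRow d) = 0 := by
  simp_rw [rowDot_eq_inner]
  rw [← integral_map (μ := gaussRow d) (φ := WithLp.toLp 2)
    (f := fun z : EuclideanSpace ℝ (Fin d) => inner ℝ u z) (by fun_prop) (by fun_prop),
    map_pi_eq_stdGaussian]
  exact integral_strongDual_stdGaussian (innerSL ℝ u)

lemma map_rowDot_gaussRow {u : EuclideanSpace ℝ (Fin d)} (hu : ‖u‖ = 1) :
    (gaussRow d).map (fun a => rowDot a u) = gaussianReal 0 1 := by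
  have h : HasGaussianLaw (fun a => rowDot a u) (gaussRow d) := by
    simp_rw [rowDot_eq_inner]
    exact hasGaussianLaw_toLp_gaussRow.map_fun (innerSL ℝ u)
  rw [h.map_eq_gaussianReal, integral_rowDot,
    ← covariance_self (measurable_rowDot _).aemeasurable, covariance_rowDot,
    real_inner_self_eq_norm_sq, hu]
  simp

lemma indepFun_rowDot {u v : EuclideanSpace ℝ (Fin d)} (huv : inner ℝ u v = 0) :
    IndepFun (fun a => rowDot a u) (fun a => rowDot a v) (gaussRow d) := by
  refine HasGaussianLaw.indepFun_of_covariance_eq_zero ?_ ((covariance_rowDot u v).trans huv)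
  simp_rw [rowDot_eq_inner]
  exact hasGaussianLaw_toLp_gaussRow.map_fun ((innerSL ℝ u).prod (innerSL ℝ v))

lemma gaussRow_real_rowDot_mem {u : EuclideanSpace ℝ (Fin d)} (hu : ‖u‖ = 1) {s : Set ℝ}
    (hs : MeasurableSet s) :
    (gaussRow d).real {a | rowDot a u ∈ s} = (gaussianReal 0 1).real s := by
  rw [← map_rowDot_gaussRow hu, map_measureReal_apply (measurable_rowDot _) hs]
  rfl

end GaussianRow

section RowEvents

variable {d : ℕ}

lemma rowDot_neg (a v : Fin d → ℝ) : rowDot a (-v) = -rowDot a v := by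
  simp [rowDot]

lemma rowDot_add (a v w : Fin d → ℝ) : rowDot a (v + w) = rowDot a v + rowDot a w := by
  simp [rowDot, mul_add, Finset.sum_add_distrib]

lemma rowDot_sub (a v w : Fin d → ℝ) : rowDot a (v - w) = rowDot a v - rowDot a w := by
  simp [rowDot, mul_sub, Finset.sum_sub_distrib]

lemma rowDot_smul (a : Fin d → ℝ) (r : ℝ) (v : Fin d → ℝ) :
    rowDot a (r • v) = r * rowDot a v := by
  simp [rowDot, Finset.mul_sum, mul_left_comm]

lemma gaussRow_real_le_abs_rowDot {x : EuclideanSpace ℝ (Fin d)} (hx : ‖x‖ = 1) {t : ℝ}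
    (ht : 0 ≤ t) :
    (gaussRow d).real {a | t ≤ |rowDot a x|} ≤ 2 * Real.exp (-t ^ 2 / 2) := by
  have hsub : {a | t ≤ |rowDot a x|} ⊆
      {a | rowDot a x ∈ Set.Ici t} ∪ {a | rowDot a (-x : EuclideanSpace ℝ (Fin d)) ∈ Set.Ici t} := by
    intro a ha
    simpa [rowDot_neg, le_abs] using ha
  have h₁ := gaussRow_real_rowDot_mem hx (measurableSet_Ici (a := t))
  have h₂ := gaussRow_real_rowDot_mem ((norm_neg x).trans hx) (measurableSet_Ici (a := t))
  have h₃ := gaussianReal_real_Ici_le ht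
  calc _ ≤ _ := measureReal_mono hsub
    _ ≤ _ := measureReal_union_le _ _
    _ ≤ _ := by rw [h₁, h₂]; linarith

lemma gaussRow_real_abs_rowDot_lt_le {x : EuclideanSpace ℝ (Fin d)} (hx : ‖x‖ = 1) {t : ℝ}
    (ht : 0 ≤ t) :
    (gaussRow d).real {a | |rowDot a x| < t} ≤
      1 - (√(2 * Real.pi))⁻¹ * Real.exp (-(t + 1) ^ 2 / 2) := by
  have hsub : {a | |rowDot a x| < t} ⊆ {a | rowDot a x ∈ Set.Ici t}ᶜ := by
    intro a ha
    simpa using (abs_lt.1 ha).2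
  have hm : MeasurableSet {a : Fin d → ℝ | rowDot a x ∈ Set.Ici t} :=
    measurable_rowDot x measurableSet_Ici
  refine (measureReal_mono hsub).trans ?_
  rw [probReal_compl_eq_one_sub hm, gaussRow_real_rowDot_mem hx measurableSet_Ici]
  have := le_gaussianReal_real_Ici ht
  linarith

lemma le_gaussRow_real_abs_rowDot_lt {x y : EuclideanSpace ℝ (Fin d)} (hx : ‖x‖ = 1)
    (hy : ‖y‖ = 1) {t : ℝ} (ht : 0 ≤ t) :
    1 - 4 * Real.exp (-t ^ 2 / 2) ≤
      (gaussRow d).real {a | |rowDot a x| < t ∧ |rowDot a y| < t} := by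
  have hm : MeasurableSet {a : Fin d → ℝ | |rowDot a x| < t ∧ |rowDot a y| < t} :=
    (measurableSet_lt (measurable_rowDot x).abs measurable_const).inter
      (measurableSet_lt (measurable_rowDot y).abs measurable_const)
  have hsub : {a : Fin d → ℝ | |rowDot a x| < t ∧ |rowDot a y| < t}ᶜ ⊆
      {a | t ≤ |rowDot a x|} ∪ {a | t ≤ |rowDot a y|} := by
    intro a ha
    simp only [Set.mem_compl_iff, Set.mem_ofPred_eq, not_and_or, not_lt] at ha
    exact ha
  have h := (measureReal_mono (μ := gaussRow d) hsub).trans (measureReal_union_le _ _)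
  rw [probReal_compl_eq_one_sub hm] at h
  have h₁ := gaussRow_real_le_abs_rowDot hx ht
  have h₂ := gaussRow_real_le_abs_rowDot hy ht
  linarith

lemma norm_add_of_unit {E : Type*} [NormedAddCommGroup E] [InnerProductSpace ℝ E] {x y : E}
    {τ : ℝ} (hx : ‖x‖ = 1) (hy : ‖y‖ = 1) (hxy : ‖x - y‖ = τ) :
    ‖x + y‖ = √(4 - τ ^ 2) := by
  have h := parallelogram_law_with_norm ℝ x y
  rw [hx, hy, hxy] at h
  rw [show 4 - τ ^ 2 = ‖x + y‖ ^ 2 by linarith, Real.sqrt_sq (norm_nonneg _)]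

variable {x y : EuclideanSpace ℝ (Fin d)} {τ t : ℝ}

lemma gaussRow_real_both_ge_le (hx : ‖x‖ = 1) (hy : ‖y‖ = 1) (hxy : ‖x - y‖ = τ)
    (hτ : 0 < τ) (hτ₂ : τ < 2) (ht : 0 ≤ t) :
    (gaussRow d).real {a | t ≤ rowDot a x ∧ t ≤ rowDot a y} ≤
      Real.exp (-(2 * t / √(4 - τ ^ 2)) ^ 2 / 2) := by
  have hn := norm_add_of_unit hx hy hxy
  have hpos : 0 < √(4 - τ ^ 2) := Real.sqrt_pos.2 (by nlinarith)
  set r := √(4 - τ ^ 2)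
  have hu : ‖r⁻¹ • (x + y)‖ = 1 := by
    rw [norm_smul, hn, norm_inv, Real.norm_of_nonneg hpos.le, inv_mul_cancel₀ hpos.ne']
  have hsub : {a | t ≤ rowDot a x ∧ t ≤ rowDot a y} ⊆
      {a | rowDot a (r⁻¹ • (x + y) : EuclideanSpace ℝ (Fin d)) ∈ Set.Ici (2 * t / r)} := by
    rintro a ⟨h₁, h₂⟩
    simp only [Set.mem_ofPred_eq, WithLp.ofLp_smul, WithLp.ofLp_add, rowDot_smul, rowDot_add,
      Set.mem_Ici]
    rw [div_eq_inv_mul]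
    gcongr
    linarith
  refine (measureReal_mono hsub).trans ?_
  rw [gaussRow_real_rowDot_mem hu measurableSet_Ici]
  exact gaussianReal_real_Ici_le (by positivity)

lemma le_gaussRow_real_both_ge (hx : ‖x‖ = 1) (hy : ‖y‖ = 1) (hxy : ‖x - y‖ = τ)
    (hτ : 0 < τ) (hτ₂ : τ < 2) (ht : 0 ≤ t) :
    (√(2 * Real.pi))⁻¹ * Real.exp (-(2 * (t + 1) / √(4 - τ ^ 2) + 1) ^ 2 / 2) *
        ((√(2 * Real.pi))⁻¹ * Real.exp (-1 / 2)) ≤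
      (gaussRow d).real {a | t ≤ rowDot a x ∧ t ≤ rowDot a y} := by
  have hn := norm_add_of_unit hx hy hxy
  have hpos : 0 < √(4 - τ ^ 2) := Real.sqrt_pos.2 (by nlinarith)
  set r := √(4 - τ ^ 2)
  have hu : ‖r⁻¹ • (x + y)‖ = 1 := by
    rw [norm_smul, hn, norm_inv, Real.norm_of_nonneg hpos.le, inv_mul_cancel₀ hpos.ne']
  have hv : ‖τ⁻¹ • (x - y)‖ = 1 := by
    rw [norm_smul, hxy, norm_inv, Real.norm_of_nonneg hτ.le, inv_mul_cancel₀ hτ.ne']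
  have huv : inner ℝ (r⁻¹ • (x + y)) (τ⁻¹ • (x - y)) = 0 := by
    rw [inner_smul_left, inner_smul_right, inner_add_left, inner_sub_right, inner_sub_right,
      real_inner_self_eq_norm_sq, real_inner_self_eq_norm_sq, real_inner_comm, hx, hy]
    simp
  have hsub : {a | rowDot a (r⁻¹ • (x + y) : EuclideanSpace ℝ (Fin d)) ∈
          Set.Ici (2 * (t + 1) / r)} ∩
        {a | rowDot a (τ⁻¹ • (x - y) : EuclideanSpace ℝ (Fin d)) ∈ Set.Icc 0 (0 + 1)} ⊆
      {a | t ≤ rowDot a x ∧ t ≤ rowDot a y} := by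
    rintro a ⟨h₁, h₂, h₃⟩
    simp only [Set.mem_ofPred_eq, WithLp.ofLp_smul, WithLp.ofLp_add, WithLp.ofLp_sub, rowDot_smul,
      rowDot_add, rowDot_sub, Set.mem_Ici] at h₁ h₂ h₃
    rw [div_eq_inv_mul, mul_le_mul_iff_right₀ (inv_pos.2 hpos)] at h₁
    rw [inv_mul_eq_div] at h₂ h₃
    rw [zero_add, div_le_one hτ] at h₃
    rw [le_div_iff₀ hτ, zero_mul] at h₂
    constructor <;> linarith
  refine le_trans ?_ (measureReal_mono hsub)
  have hi := (indepFun_iff_measure_inter_preimage_eq_mul.1 (indepFun_rowDot huv))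
    (Set.Ici (2 * (t + 1) / r)) (Set.Icc 0 (0 + 1)) measurableSet_Ici measurableSet_Icc
  have hi' := congrArg ENNReal.toReal hi
  rw [ENNReal.toReal_mul] at hi'
  refine le_trans ?_ hi'.ge
  change _ ≤ (gaussRow d).real {a | rowDot a (r⁻¹ • (x + y) : EuclideanSpace ℝ (Fin d)) ∈ _} *
    (gaussRow d).real {a | rowDot a (τ⁻¹ • (x - y) : EuclideanSpace ℝ (Fin d)) ∈ _}
  rw [gaussRow_real_rowDot_mem hu measurableSet_Ici, gaussRow_real_rowDot_mem hv measurableSet_Icc]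
  gcongr
  · exact le_gaussianReal_real_Ici (by positivity)
  · simpa using le_gaussianReal_real_Icc (t := 0) le_rfl

end RowEvents

section Product

lemma pi_real_iUnion_single {α : Type*} [MeasurableSpace α] (ν : Measure α)
    [IsProbabilityMeasure ν] (d : ℕ) {S B : Set α} (hS : MeasurableSet S) (hB : MeasurableSet B)
    (hSB : Disjoint S B) :
    (Measure.pi fun _ : Fin d => ν).real (⋃ i, Set.univ.pi fun j => if j = i then S else B) =
      d * (ν.real S * ν.real B ^ (d - 1)) := by
  have hm (i : Fin d) : MeasurableSet (Set.univ.pi fun j => if j = i then S else B) :=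
    MeasurableSet.univ_pi fun j => by split_ifs <;> assumption
  have hd : Pairwise (Function.onFun Disjoint
      fun i : Fin d => Set.univ.pi fun j => if j = i then S else B) := by
    intro i k hik
    refine Set.disjoint_left.2 fun A h₁ h₂ => ?_
    have h₁ := h₁ i trivial
    have h₂ := h₂ i trivial
    simp only [if_true, if_neg hik] at h₁ h₂
    exact Set.disjoint_left.1 hSB h₁ h₂
  rw [measureReal_def, measure_iUnion hd hm, tsum_fintype,
    ENNReal.toReal_sum fun _ _ => measure_ne_top _ _]
  have hi (i : Fin d) : ((Measure.pi fun _ : Fin d => ν)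
      (Set.univ.pi fun j => if j = i then S else B)).toReal = ν.real S * ν.real B ^ (d - 1) := by
    rw [Measure.pi_pi, ← Finset.mul_prod_erase _ _ (Finset.mem_univ i), if_pos rfl,
      Finset.prod_congr rfl fun j hj => by rw [if_neg (Finset.ne_of_mem_erase hj)]]
    simp [measureReal_def, ENNReal.toReal_mul, ENNReal.toReal_pow]
  simp_rw [hi]
  simp

lemma pi_real_eval_mem {α : Type*} [MeasurableSpace α] (ν : Measure α)
    [IsProbabilityMeasure ν] {d : ℕ} {S : Set α} (hS : MeasurableSet S) (i : Fin d) :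
    (Measure.pi fun _ : Fin d => ν).real {A | A i ∈ S} = ν.real S := by
  rw [measureReal_def, measureReal_def,
    ← (measurePreserving_eval (fun _ : Fin d => ν) i).measure_preimage hS.nullMeasurableSet]
  rfl

end Product

section Collision

variable {d : ℕ}

lemma hashAt.abs_le (hd : 2 ≤ d) {A : Fin d → Fin d → ℝ} {v : Fin d → ℝ} {i : Fin d} {s : ℝ}
    (hs : s = 1 ∨ s = -1) (h : hashAt A v i s) (j : Fin d) : |mvMul A v j| ≤ s * mvMul A v i := by
  have : Nontrivial (Fin d) := Fin.nontrivial_iff_two_le.2 hd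
  obtain ⟨k, hk⟩ := exists_ne i
  have hpos := (abs_nonneg _).trans_lt (h k hk)
  by_cases hj : j = i
  · subst hj
    rcases hs with rfl | rfl <;> refine _root_.abs_le.2 ⟨?_, ?_⟩ <;> linarith
  · exact (h j hj).le

variable {x y : EuclideanSpace ℝ (Fin d)} {τ t : ℝ}

lemma measurableSet_both_ge (x y : Fin d → ℝ) (t : ℝ) :
    MeasurableSet {a : Fin d → ℝ | t ≤ rowDot a x ∧ t ≤ rowDot a y} :=
  (measurableSet_le measurable_const (measurable_rowDot x)).inter
    (measurableSet_le measurable_const (measurable_rowDot y))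

lemma collProb_le (hd : 2 ≤ d) (hx : ‖x‖ = 1) (hy : ‖y‖ = 1) (hxy : ‖x - y‖ = τ)
    (hτ : 0 < τ) (hτ₂ : τ < 2) (ht : 0 ≤ t) :
    collProb d x y ≤ 2 * d * Real.exp (-(2 * t / √(4 - τ ^ 2)) ^ 2 / 2) +
      2 * (1 - (√(2 * Real.pi))⁻¹ * Real.exp (-(t + 1) ^ 2 / 2)) ^ d := by
  let S (u v : EuclideanSpace ℝ (Fin d)) : Set (Fin d → ℝ) :=
    {a | t ≤ rowDot a u ∧ t ≤ rowDot a v}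
  let T (u : EuclideanSpace ℝ (Fin d)) : Set (Fin d → ℝ) := {a | |rowDot a u| < t}
  have hsub : {A : Fin d → Fin d → ℝ | collide A x y} ⊆
      ((⋃ i, {A | A i ∈ S x y}) ∪ (⋃ i, {A | A i ∈ S (-x) (-y)})) ∪
        ((Set.univ.pi fun _ => T x) ∪ (Set.univ.pi fun _ => T y)) := by
    rintro A ⟨i, s, hs, h₁, h₂⟩
    by_cases hX : ∀ j, |rowDot (A j) x| < t
    · exact .inr (.inl fun j _ => hX j)
    by_cases hY : ∀ j, |rowDot (A j) y| < t
    · exact .inr (.inr fun j _ => hY j)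
    push Not at hX hY
    obtain ⟨j, hj⟩ := hX
    obtain ⟨k, hk⟩ := hY
    have hX : t ≤ s * rowDot (A i) x := hj.trans (h₁.abs_le hd hs j)
    have hY : t ≤ s * rowDot (A i) y := hk.trans (h₂.abs_le hd hs k)
    rcases hs with rfl | rfl
    · rw [one_mul] at hX hY
      exact .inl (.inl (Set.mem_iUnion.2 ⟨i, hX, hY⟩))
    · rw [neg_one_mul] at hX hY
      refine .inl (.inr (Set.mem_iUnion.2 ⟨i, ?_, ?_⟩))
      · rwa [WithLp.ofLp_neg, rowDot_neg]
      · rwa [WithLp.ofLp_neg, rowDot_neg]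
  have hS (u v : EuclideanSpace ℝ (Fin d)) (hu : ‖u‖ = 1) (hv : ‖v‖ = 1) (huv : ‖u - v‖ = τ) :
      (gaussMatrix d d).real (⋃ i, {A | A i ∈ S u v}) ≤
        d * Real.exp (-(2 * t / √(4 - τ ^ 2)) ^ 2 / 2) := by
    refine (measureReal_iUnion_fintype_le _).trans ?_
    have h (i : Fin d) : (gaussMatrix d d).real {A | A i ∈ S u v} ≤
        Real.exp (-(2 * t / √(4 - τ ^ 2)) ^ 2 / 2) := by
      rw [gaussMatrix, pi_real_eval_mem (gaussRow d) (measurableSet_both_ge _ _ _)]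
      exact gaussRow_real_both_ge_le hu hv huv hτ hτ₂ ht
    simpa using Finset.sum_le_sum fun i (_ : i ∈ Finset.univ) => h i
  have hT (u : EuclideanSpace ℝ (Fin d)) (hu : ‖u‖ = 1) :
      (gaussMatrix d d).real (Set.univ.pi fun _ => T u) ≤
        (1 - (√(2 * Real.pi))⁻¹ * Real.exp (-(t + 1) ^ 2 / 2)) ^ d := by
    rw [gaussMatrix, measureReal_def, Measure.pi_pi, Finset.prod_const, Finset.card_univ,
      Fintype.card_fin, ENNReal.toReal_pow]
    exact pow_le_pow_left₀ ENNReal.toReal_nonneg (gaussRow_real_abs_rowDot_lt_le hu ht) d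
  have : IsProbabilityMeasure (gaussMatrix d d) := by unfold gaussMatrix; infer_instance
  have h₁ := hS x y hx hy hxy
  have h₂ := hS (-x) (-y) (by rwa [norm_neg]) (by rwa [norm_neg])
    (by rw [← neg_sub', norm_neg, hxy])
  have h₃ := hT x hx
  have h₄ := hT y hy
  calc collProb d x y ≤ _ := measureReal_mono (μ := gaussMatrix d d) hsub
    _ ≤ _ := measureReal_union_le _ _
    _ ≤ _ := add_le_add (measureReal_union_le _ _) (measureReal_union_le _ _)
    _ ≤ _ := by linarith

lemma le_collProb (hx : ‖x‖ = 1) (hy : ‖y‖ = 1) (hxy : ‖x - y‖ = τ)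
    (hτ : 0 < τ) (hτ₂ : τ < 2) (ht : 0 ≤ t) (hdt : 4 * d * Real.exp (-t ^ 2 / 2) ≤ 1 / 2) :
    d * ((√(2 * Real.pi))⁻¹ * Real.exp (-(2 * (t + 1) / √(4 - τ ^ 2) + 1) ^ 2 / 2) *
        ((√(2 * Real.pi))⁻¹ * Real.exp (-1 / 2)) * (1 / 2)) ≤ collProb d x y := by
  rcases Nat.eq_zero_or_pos d with rfl | hd
  · simp [collProb]
  let S : Set (Fin d → ℝ) := {a | t ≤ rowDot a x ∧ t ≤ rowDot a y}
  let B : Set (Fin d → ℝ) := {a | |rowDot a x| < t ∧ |rowDot a y| < t}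
  have hB : MeasurableSet B :=
    (measurableSet_lt (measurable_rowDot x).abs measurable_const).inter
      (measurableSet_lt (measurable_rowDot y).abs measurable_const)
  have hSB : Disjoint S B := Set.disjoint_left.2 fun a h₁ h₂ =>
    (h₂.1.trans_le h₁.1).not_ge (le_abs_self _)
  have hsub : (⋃ i, Set.univ.pi fun j => if j = i then S else B) ⊆
      {A : Fin d → Fin d → ℝ | collide A x y} := by
    intro A hA
    obtain ⟨i, hi⟩ := Set.mem_iUnion.1 hA
    have hS : A i ∈ S := by simpa using hi i trivial
    refine ⟨i, 1, .inl rfl, fun j hj => ?_, fun j hj => ?_⟩ <;>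
    · have hB := hi j trivial
      simp only [if_neg hj] at hB
      rw [one_mul]
      first | exact hB.1.trans_le hS.1 | exact hB.2.trans_le hS.2
  have : IsProbabilityMeasure (gaussMatrix d d) := by unfold gaussMatrix; infer_instance
  refine le_trans ?_ (measureReal_mono (μ := gaussMatrix d d) hsub)
  rw [gaussMatrix, pi_real_iUnion_single (gaussRow d) d (measurableSet_both_ge _ _ _) hB hSB]
  have hq : 1 / 2 ≤ (gaussRow d).real B ^ (d - 1) := by
    have h₁ := le_gaussRow_real_abs_rowDot_lt hx hy ht
    have hd1 : (1 : ℝ) ≤ d := by exact_mod_cast hd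
    have he := Real.exp_pos (-t ^ 2 / 2)
    have h₂ := one_add_mul_le_pow (a := -(4 * Real.exp (-t ^ 2 / 2))) (by nlinarith) d
    calc (1 : ℝ) / 2 ≤ (1 + -(4 * Real.exp (-t ^ 2 / 2))) ^ d := by linarith
      _ ≤ (gaussRow d).real B ^ d := pow_le_pow_left₀ (by nlinarith) (by linarith) d
      _ ≤ _ := pow_le_pow_of_le_one measureReal_nonneg measureReal_le_one (Nat.sub_le d 1)
  gcongr
  exact le_gaussRow_real_both_ge hx hy hxy hτ hτ₂ ht

end Collision

section Asymptotics

variable {τ : ℝ} {x y : (d : ℕ) → EuclideanSpace ℝ (Fin d)}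

lemma tendsto_sqrt_two_mul_log_natCast :
    Tendsto (fun d : ℕ => √(2 * Real.log d)) atTop atTop :=
  Real.tendsto_sqrt_atTop.comp
    ((Real.tendsto_log_atTop.comp tendsto_natCast_atTop_atTop).const_mul_atTop two_pos)

lemma sq_sqrt_two_mul_log_natCast (d : ℕ) : √(2 * Real.log d) ^ 2 = 2 * Real.log d :=
  Real.sq_sqrt (mul_nonneg zero_le_two (Real.log_natCast_nonneg d))

lemma natCast_eq_exp_sqrt_two_mul_log {d : ℕ} (hd : 0 < d) :
    (d : ℝ) = Real.exp (√(2 * Real.log d) ^ 2 / 2) := by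
  rw [sq_sqrt_two_mul_log_natCast, mul_div_cancel_left₀ _ two_ne_zero,
    Real.exp_log (by exact_mod_cast hd)]

/-- A lower bound on the collision probability, at the threshold `√(2 log d) + 3`. -/
lemma exists_le_collProb (hτ : 0 < τ) (hτ₂ : τ < 2)
    (hx : ∀ d, 2 ≤ d → ‖x d‖ = 1) (hy : ∀ d, 2 ≤ d → ‖y d‖ = 1)
    (hxy : ∀ d, 2 ≤ d → ‖x d - y d‖ = τ) :
    ∃ K > 0, ∀ d : ℕ, 2 ≤ d →
      K * Real.exp (√(2 * Real.log d) ^ 2 / 2 -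
        (2 * (√(2 * Real.log d) + 4) / √(4 - τ ^ 2) + 1) ^ 2 / 2) ≤ collProb d (x d) (y d) := by
  refine ⟨(√(2 * Real.pi))⁻¹ * ((√(2 * Real.pi))⁻¹ * Real.exp (-1 / 2)) * (1 / 2), by positivity,
    fun d hd => ?_⟩
  have hs := Real.sqrt_nonneg (2 * Real.log d)
  have hd' := natCast_eq_exp_sqrt_two_mul_log (show 0 < d by omega)
  set s := √(2 * Real.log d)
  have hdt : 4 * d * Real.exp (-(s + 3) ^ 2 / 2) ≤ 1 / 2 := by
    rw [hd', mul_assoc, ← Real.exp_add]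
    have h₁ : Real.exp (s ^ 2 / 2 + -(s + 3) ^ 2 / 2) ≤ Real.exp (-(3 : ℕ) * 1) :=
      Real.exp_le_exp.2 (by push_cast; nlinarith)
    have h₂ : Real.exp (-(3 : ℕ) * 1) ≤ 1 / 8 := by
      rw [neg_mul, Real.exp_neg, Real.exp_nat_mul, inv_le_comm₀ (by positivity) (by norm_num)]
      have := Real.add_one_le_exp 1
      calc (1 / 8 : ℝ)⁻¹ = (1 + 1) ^ 3 := by norm_num
        _ ≤ _ := by gcongr
    linarith
  have h := le_collProb (hx d hd) (hy d hd) (hxy d hd) hτ hτ₂ (t := s + 3) (by linarith) hdt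
  refine le_trans (le_of_eq ?_) h
  rw [hd']
  rw [sub_eq_add_neg, Real.exp_add, ← neg_div, add_assoc s 3 1, show (3 : ℝ) + 1 = 4 by norm_num]
  ring

/-- An upper bound on the collision probability, at the threshold `√(2 log d) - 2`. -/
lemma eventually_collProb_le (hτ : 0 < τ) (hτ₂ : τ < 2)
    (hx : ∀ d, 2 ≤ d → ‖x d‖ = 1) (hy : ∀ d, 2 ≤ d → ‖y d‖ = 1)
    (hxy : ∀ d, 2 ≤ d → ‖x d - y d‖ = τ) :
    ∀ᶠ d : ℕ in atTop, collProb d (x d) (y d) ≤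
      4 * Real.exp (√(2 * Real.log d) ^ 2 / 2 -
        (2 * (√(2 * Real.log d) - 2) / √(4 - τ ^ 2)) ^ 2 / 2) := by
  set C := (√(2 * Real.pi))⁻¹
  set r := √(4 - τ ^ 2)
  have hr : 0 < r := Real.sqrt_pos.2 (by nlinarith)
  have hC : 0 < C := by positivity
  have hC₁ : C ≤ 1 := inv_le_one_of_one_le₀ (Real.one_le_sqrt.2 (by linarith [Real.pi_gt_three]))
  have hlarge : ∀ᶠ s : ℝ in atTop, 2 / (r ^ 2 * C * Real.exp (-1 / 2)) ≤ Real.exp s / s ^ 2 :=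
    (Real.tendsto_exp_div_pow_atTop 2).eventually_ge_atTop _
  filter_upwards [eventually_ge_atTop 2, tendsto_sqrt_two_mul_log_natCast.eventually hlarge,
    tendsto_sqrt_two_mul_log_natCast.eventually_ge_atTop 2] with d hd hlarge hs
  have hd' := natCast_eq_exp_sqrt_two_mul_log (show 0 < d by omega)
  set s := √(2 * Real.log d)
  have h := collProb_le hd (hx d hd) (hy d hd) (hxy d hd) hτ hτ₂ (t := s - 2) (by linarith)
  have hpow : (1 - C * Real.exp (-(s - 2 + 1) ^ 2 / 2)) ^ d ≤
      Real.exp (-(2 * (s - 2) / r) ^ 2 / 2) := by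
    have he : Real.exp (-(s - 2 + 1) ^ 2 / 2) ≤ 1 := Real.exp_le_one_iff.2 (by nlinarith)
    have hnn : 0 ≤ 1 - C * Real.exp (-(s - 2 + 1) ^ 2 / 2) := by
      nlinarith [Real.exp_pos (-(s - 2 + 1) ^ 2 / 2)]
    refine (pow_le_pow_left₀ hnn (Real.one_sub_le_exp_neg _) d).trans ?_
    rw [← Real.exp_nat_mul, Real.exp_le_exp]
    have hexp : (d : ℝ) * (C * Real.exp (-(s - 2 + 1) ^ 2 / 2)) =
        C * Real.exp (-1 / 2) * Real.exp s := by
      rw [hd', mul_left_comm, ← Real.exp_add, mul_assoc, ← Real.exp_add]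
      congr 2
      ring
    rw [mul_neg, hexp]
    rw [div_le_div_iff₀ (by positivity) (by positivity)] at hlarge
    have : (2 * (s - 2) / r) ^ 2 / 2 ≤ C * Real.exp (-1 / 2) * Real.exp s := by
      rw [div_pow, div_div, div_le_iff₀ (by positivity)]
      nlinarith
    linarith
  have hd1 : (1 : ℝ) ≤ d := by exact_mod_cast (by omega : 1 ≤ d)
  have hE := Real.exp_pos (-(2 * (s - 2) / r) ^ 2 / 2)
  calc collProb d (x d) (y d) ≤ _ := h
    _ ≤ 4 * (d * Real.exp (-(2 * (s - 2) / r) ^ 2 / 2)) := by nlinarith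
    _ = _ := by
      nth_rewrite 1 [hd']
      rw [← Real.exp_add]
      congr 2
      ring

lemma tendsto_log_collProb_div_log (hτ : 0 < τ) (hτ₂ : τ < 2)
    (hx : ∀ d, 2 ≤ d → ‖x d‖ = 1) (hy : ∀ d, 2 ≤ d → ‖y d‖ = 1)
    (hxy : ∀ d, 2 ≤ d → ‖x d - y d‖ = τ) :
    Tendsto (fun d : ℕ => Real.log (1 / collProb d (x d) (y d)) / Real.log d) atTop
      (nhds (τ ^ 2 / (4 - τ ^ 2))) := by
  obtain ⟨K, hK, hlower⟩ := exists_le_collProb hτ hτ₂ hx hy hxy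
  have hupper := eventually_collProb_le hτ hτ₂ hx hy hxy
  have hτ4 : 0 < 4 - τ ^ 2 := by nlinarith
  have hr : 0 < √(4 - τ ^ 2) := Real.sqrt_pos.2 hτ4
  have hr₂ : √(4 - τ ^ 2) ^ 2 = 4 - τ ^ 2 := Real.sq_sqrt hτ4.le
  set r := √(4 - τ ^ 2)
  have hinv : Tendsto (fun d : ℕ => (√(2 * Real.log d))⁻¹) atTop (nhds 0) :=
    tendsto_inv_atTop_zero.comp tendsto_sqrt_two_mul_log_natCast
  have hlim {g : ℝ → ℝ} (hg : Continuous g) (hg₀ : g 0 = (2 / r) ^ 2 - 1) :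
      Tendsto (fun d : ℕ => g (√(2 * Real.log d))⁻¹) atTop (nhds (τ ^ 2 / (4 - τ ^ 2))) := by
    have : τ ^ 2 / (4 - τ ^ 2) = g 0 := by
      rw [hg₀, div_pow, hr₂]
      field_simp
      ring
    rw [this]
    exact (hg.tendsto 0).comp hinv
  refine tendsto_of_tendsto_of_tendsto_of_le_of_le'
    (hlim (g := fun w => (2 / r * (1 - 2 * w)) ^ 2 - 1 - 2 * Real.log 4 * w ^ 2)
      (by fun_prop) (by simp))
    (hlim (g := fun w => (2 / r * (1 + 4 * w) + w) ^ 2 - 1 - 2 * Real.log K * w ^ 2)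
      (by fun_prop) (by simp)) ?_ ?_
  · filter_upwards [hupper, eventually_ge_atTop 2,
      tendsto_sqrt_two_mul_log_natCast.eventually_gt_atTop 0] with d hup hd hs
    have hp := (by positivity : (0 : ℝ) < _).trans_le (hlower d hd)
    have hlog := Real.log_le_log hp hup
    rw [Real.log_mul (by norm_num) (Real.exp_ne_zero _), Real.log_exp] at hlog
    have hL : Real.log d = √(2 * Real.log d) ^ 2 / 2 := by
      rw [sq_sqrt_two_mul_log_natCast]; ring
    rw [one_div, Real.log_inv]
    nth_rewrite 3 [hL]
    set s := √(2 * Real.log d)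
    rw [le_div_iff₀ (by positivity)]
    refine le_trans (le_of_eq ?_) (neg_le_neg hlog)
    field_simp
    ring
  · filter_upwards [eventually_ge_atTop 2,
      tendsto_sqrt_two_mul_log_natCast.eventually_gt_atTop 0] with d hd hs
    have hlog := Real.log_le_log (by positivity) (hlower d hd)
    rw [Real.log_mul hK.ne' (Real.exp_ne_zero _), Real.log_exp] at hlog
    have hL : Real.log d = √(2 * Real.log d) ^ 2 / 2 := by
      rw [sq_sqrt_two_mul_log_natCast]; ring
    rw [one_div, Real.log_inv]
    nth_rewrite 1 [hL]
    set s := √(2 * Real.log d)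
    rw [div_le_iff₀ (by positivity)]
    refine (neg_le_neg hlog).trans (le_of_eq ?_)
    field_simp
    ring

end Asymptotics

/-- The sensitivity exponent of cross-polytope LSH tends to the optimal value
`(1/c²)·(4 − c²R²)/(4 − R²)` as `d → ∞`, for any sequences of unit vectors at
distances `R` and `cR` respectively. -/
theorem stmt_12 (R c : ℝ) (hR : 0 < R) (hR2 : R < 2) (hc : 1 < c) (hcR : c * R < 2)
    (x y x' y' : (d : ℕ) → EuclideanSpace ℝ (Fin d))
    (hx : ∀ d, 2 ≤ d → ‖x d‖ = 1) (hy : ∀ d, 2 ≤ d → ‖y d‖ = 1)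
    (hxy : ∀ d, 2 ≤ d → ‖x d - y d‖ = R)
    (hx' : ∀ d, 2 ≤ d → ‖x' d‖ = 1) (hy' : ∀ d, 2 ≤ d → ‖y' d‖ = 1)
    (hxy' : ∀ d, 2 ≤ d → ‖x' d - y' d‖ = c * R) :
    Tendsto (fun d =>
        Real.log (1 / collProb d (fun i => x d i) (fun i => y d i)) /
          Real.log (1 / collProb d (fun i => x' d i) (fun i => y' d i)))
      atTop (nhds (1 / c ^ 2 * ((4 - c ^ 2 * R ^ 2) / (4 - R ^ 2)))) := by
  have hcR₀ : 0 < c * R := by positivity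
  have h₁ := tendsto_log_collProb_div_log hR hR2 hx hy hxy
  have h₂ := tendsto_log_collProb_div_log hcR₀ hcR hx' hy' hxy'
  have hR4 : 0 < 4 - R ^ 2 := by nlinarith
  have hcR4 : 0 < 4 - (c * R) ^ 2 := by nlinarith
  have hlim : 1 / c ^ 2 * ((4 - c ^ 2 * R ^ 2) / (4 - R ^ 2)) =
      R ^ 2 / (4 - R ^ 2) / ((c * R) ^ 2 / (4 - (c * R) ^ 2)) := by
    rw [← mul_pow]
    field_simp
  rw [hlim]
  refine (h₁.div h₂ (by positivity)).congr' ?_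
  filter_upwards [eventually_ge_atTop 2] with d hd
  exact div_div_div_cancel_right₀
    (Real.log_pos (by exact_mod_cast hd)).ne' _ _
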